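/- arXiv:1108.0817 — 6 statements merged into one kernel-verified Lean document; each statement's English description precedes it below -/
import Mathlib

section
/- For every algebraic system S over R = F[x₁,…,x_n] there exists a Thomas decomposition of S, i.e., finitely many simple systems S₁,…,S_m over R such that Sol(S) is the union of Sol(S₁),…,Sol(S_m) and these solution sets are pairwise disjoint. -/
open MvPolynomial

/-- An algebraic system over `F[x₁,…,xₙ]`: a finite set of equations `p = 0`
and a finite set of inequations `p ≠ 0`. -/
structure AlgSystem (F : Type*) [Field F] (n : ℕ) where
  eqs : Finset (MvPolynomial (Fin n) F)
  ineqs : Finset (MvPolynomial (Fin n) F)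

variable {F : Type*} [Field F] [CharZero F] {n : ℕ}

/-- `k` is the leader of `p`: the largest variable occurring in `p`. -/
def IsLeader (p : MvPolynomial (Fin n) F) (k : Fin n) : Prop :=
  k ∈ p.vars ∧ ∀ j ∈ p.vars, j ≤ k

/-- membership of a polynomial in a system (as an equation or an inequation). -/
def AlgSystem.Mem (S : AlgSystem F n) (p : MvPolynomial (Fin n) F) : Prop :=
  p ∈ S.eqs ∨ p ∈ S.ineqs

/-- `a ∈ Sol(S)`: `a` satisfies all equations and inequations of `S`. -/
def Sol (S : AlgSystem F n) (a : Fin n → AlgebraicClosure F) : Prop :=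
  (∀ p ∈ S.eqs, aeval a p = 0) ∧ (∀ p ∈ S.ineqs, aeval a p ≠ 0)

/-- `a` is a solution of the subsystem `S_{<x_k}` of all members of `S` whose
variables are all `< x_k` (only the coordinates `< k` of `a` matter). -/
def SolBelow (S : AlgSystem F n) (k : Fin n) (a : Fin n → AlgebraicClosure F) : Prop :=
  (∀ p ∈ S.eqs, (∀ j ∈ p.vars, j < k) → aeval a p = 0) ∧
  (∀ p ∈ S.ineqs, (∀ j ∈ p.vars, j < k) → aeval a p ≠ 0)

/-- `a` is a solution of the subsystem `S_{≤x_k}` of all members of `S` whose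
variables are all `≤ x_k` (only the coordinates `≤ k` of `a` matter). -/
def SolUpTo (S : AlgSystem F n) (k : Fin n) (a : Fin n → AlgebraicClosure F) : Prop :=
  (∀ p ∈ S.eqs, (∀ j ∈ p.vars, j ≤ k) → aeval a p = 0) ∧
  (∀ p ∈ S.ineqs, (∀ j ∈ p.vars, j ≤ k) → aeval a p ≠ 0)

/-- `φ_{<x_k,a}(p)`: the univariate polynomial over `F̄` obtained from `p` by
substituting `a i` for `x_i` (`i ≠ k`) and keeping `x_k` as the variable. -/
noncomputable def uni (a : Fin n → AlgebraicClosure F) (k : Fin n)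
    (p : MvPolynomial (Fin n) F) : Polynomial (AlgebraicClosure F) :=
  aeval (fun i => if i = k then (Polynomial.X : Polynomial (AlgebraicClosure F))
    else Polynomial.C (a i)) p

/-- The initial of `p` with respect to the variable `x_k`: the leading coefficient
of `p` regarded as a univariate polynomial in `x_k`. -/
noncomputable def initOf (p : MvPolynomial (Fin n) F) (k : Fin n) :
    MvPolynomial (Fin n) F :=
  ∑ m ∈ p.support.filter (fun m => m k = p.degreeOf k),
    monomial (m.erase k) (coeff m p)

/-- Triangularity: at most one member of `S` has leader `x_k`, for each `k`,
and `S` contains no constant polynomial. -/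
def Triangular (S : AlgSystem F n) : Prop :=
  (∀ k : Fin n, ∀ p, S.Mem p → ∀ q, S.Mem q → IsLeader p k → IsLeader q k → p = q) ∧
  (∀ k : Fin n, ∀ p, IsLeader p k → ¬(p ∈ S.eqs ∧ p ∈ S.ineqs)) ∧
  (∀ p, S.Mem p → p.vars.Nonempty)

/-- Non-vanishing initials: for every member `p` of `S` with leader `x_k` and every
solution `a` of `S_{<x_k}`, `init(p)` does not vanish at `a`. -/
def NonVanishingInitials (S : AlgSystem F n) : Prop :=
  ∀ k : Fin n, ∀ p, S.Mem p → IsLeader p k →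
    ∀ a : Fin n → AlgebraicClosure F, SolBelow S k a → aeval a (initOf p k) ≠ 0

/-- Square-freeness: for every member `p` of `S` with leader `x_k` and every
solution `a` of `S_{<x_k}`, the univariate polynomial `φ_{<x_k,a}(p)` is squarefree. -/
def SquarefreeCond (S : AlgSystem F n) : Prop :=
  ∀ k : Fin n, ∀ p, S.Mem p → IsLeader p k →
    ∀ a : Fin n → AlgebraicClosure F, SolBelow S k a → Squarefree (uni a k p)

/-- A simple system. -/
def Simple (S : AlgSystem F n) : Prop :=
  Triangular S ∧ NonVanishingInitials S ∧ SquarefreeCond S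

section Univariate

variable {A L : Type*} [CommRing A] [Field L]

/-- A set of specializations is split by finitely many case distinctions into good pieces. -/
inductive SplitDec (Good : Set (A →+* L) → Prop) : Set (A →+* L) → Prop
  | leaf (C : Set (A →+* L)) : Good C → SplitDec Good C
  | split (C : Set (A →+* L)) (f : A) : SplitDec Good (C ∩ {φ | φ f = 0}) →
      SplitDec Good (C ∩ {φ | φ f ≠ 0}) → SplitDec Good C

theorem SplitDec.bind {G G' : Set (A →+* L) → Prop} {C : Set (A →+* L)} (h : SplitDec G C) :
    (∀ D, D ⊆ C → G D → SplitDec G' D) → SplitDec G' C := by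
  induction h with
  | leaf C hC => intro H; exact H C subset_rfl hC
  | split C f _ _ ih1 ih2 =>
    intro H
    refine .split C f (ih1 fun D hD => H D (hD.trans Set.inter_subset_left))
      (ih2 fun D hD => H D (hD.trans Set.inter_subset_left))

/-- all coefficients of index at least `a` vanish -/
def CoeffBd (f : Polynomial A) (a : ℕ) : Prop := ∀ m, a ≤ m → f.coeff m = 0

/-- `h` has degree exactly `d` at each specialization in `D` -/
def NVan (D : Set (A →+* L)) (h : Polynomial A) (d : ℕ) : Prop :=
  CoeffBd h (d + 1) ∧ ∀ φ ∈ D, φ (h.coeff d) ≠ 0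

theorem NVan.mono {C D : Set (A →+* L)} {h : Polynomial A} {d : ℕ} (H : NVan C h d) (hD : D ⊆ C) :
    NVan D h d := ⟨H.1, fun φ hφ => H.2 φ (hD hφ)⟩

theorem NVan.ne_zero {D : Set (A →+* L)} {h : Polynomial A} {d : ℕ} (H : NVan D h d)
    {φ : A →+* L} (hφ : φ ∈ D) : h.map φ ≠ 0 := by
  intro h0
  apply H.2 φ hφ
  rw [← Polynomial.coeff_map, h0, Polynomial.coeff_zero]

theorem NVan.natDegree_map {D : Set (A →+* L)} {h : Polynomial A} {d : ℕ} (H : NVan D h d)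
    {φ : A →+* L} (hφ : φ ∈ D) : (h.map φ).natDegree = d := by
  apply le_antisymm
  · rw [Polynomial.natDegree_le_iff_coeff_eq_zero]
    intro m hm
    rw [Polynomial.coeff_map, H.1 m hm, map_zero]
  · apply Polynomial.le_natDegree_of_ne_zero
    rw [Polynomial.coeff_map]; exact H.2 φ hφ

theorem coeffBd_succ_erase {f : Polynomial A} {a : ℕ} (hf : CoeffBd f (a + 1)) :
    CoeffBd (f.erase a) a := by
  intro m hm
  rw [Polynomial.coeff_erase]
  split_ifs with h
  · rfl
  · exact hf m (by omega)

theorem map_erase_eq {f : Polynomial A} {a : ℕ} {φ : A →+* L} (h : φ (f.coeff a) = 0) :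
    (f.erase a).map φ = f.map φ := by
  ext m
  rw [Polynomial.coeff_map, Polynomial.coeff_map, Polynomial.coeff_erase]
  split_ifs with hm
  · rw [hm, h, map_zero]
  · rfl

theorem coeffBd_zero {f : Polynomial A} (hf : CoeffBd f 0) : f = 0 := by
  ext m; simp [hf m (Nat.zero_le m)]

theorem exists_coeffBd (f : Polynomial A) : ∃ a, CoeffBd f a :=
  ⟨f.natDegree + 1, fun m hm => Polynomial.coeff_eq_zero_of_natDegree_lt (by omega)⟩

theorem coeffBd_cancel {f g : Polynomial A} {a b : ℕ} (hf : CoeffBd f (a + 1))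
    (hg : CoeffBd g (b + 1)) (hab : b ≤ a) :
    CoeffBd (Polynomial.C (g.coeff b) * f
      - Polynomial.C (f.coeff a) * (Polynomial.X ^ (a - b) * g)) a := by
  intro m hm
  obtain ⟨j, rfl⟩ : ∃ j, m = (b + j) + (a - b) := ⟨m - a, by omega⟩
  rw [Polynomial.coeff_sub, Polynomial.coeff_C_mul, Polynomial.coeff_C_mul,
    Polynomial.coeff_X_pow_mul]
  rcases Nat.eq_zero_or_pos j with rfl | hj
  · have : b + 0 + (a - b) = a := by omega
    rw [this, add_zero]; ring
  · rw [hf (b + j + (a - b)) (by omega), hg (b + j) (by omega)]; ring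

/-- the divisor characterization of a gcd -/
def GcdLike (h f g : Polynomial L) : Prop := ∀ d, d ∣ h ↔ d ∣ f ∧ d ∣ g

theorem GcdLike.cancel {h f g u : Polynomial L} {c : L} (hc : c ≠ 0)
    (H : GcdLike h (Polynomial.C c * f - u * g) g) : GcdLike h f g := by
  intro d
  rw [H d]
  refine and_congr_left fun hg => ?_
  rw [dvd_sub_left (hg.mul_left u)]
  exact (Polynomial.isUnit_C.2 hc.isUnit).dvd_mul_left

theorem GcdLike.symm {h f g : Polynomial L} (H : GcdLike h f g) : GcdLike h g f :=
  fun d => by rw [H d, and_comm]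

def GcdGood (f g : Polynomial A) (D : Set (A →+* L)) : Prop :=
  ∃ h : Polynomial A, (h = 0 ∨ ∃ d, NVan D h d) ∧
    ∀ φ ∈ D, GcdLike (h.map φ) (f.map φ) (g.map φ)

theorem GcdGood.symm {f g : Polynomial A} {D : Set (A →+* L)} (H : GcdGood f g D) :
    GcdGood g f D := by
  obtain ⟨h, h1, h2⟩ := H
  exact ⟨h, h1, fun φ hφ => (h2 φ hφ).symm⟩

theorem gcd_dec : ∀ (N a b : ℕ) (_ : a + b ≤ N) (f g : Polynomial A) (_ : CoeffBd f a)
    (_ : CoeffBd g b) (C : Set (A →+* L)), SplitDec (GcdGood f g) C := by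
  intro N
  induction N with
  | zero =>
    intro a b hab f g hf hg C
    obtain rfl : a = 0 := by omega
    obtain rfl : b = 0 := by omega
    rw [coeffBd_zero hf, coeffBd_zero hg]
    refine .leaf _ ⟨0, Or.inl rfl, fun φ _ d => by simp⟩
  | succ N ih =>
    have key : ∀ (a b : ℕ) (_ : a + 1 + b ≤ N + 1) (_ : b ≤ a + 1) (f g : Polynomial A)
      (_ : CoeffBd f (a + 1)) (_ : CoeffBd g b) (C : Set (A →+* L)),
        SplitDec (GcdGood f g) C := by
      intro a b hab hba f g hf hg C
      refine .split _ (f.coeff a) ?_ ?_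
      · refine (ih a b (by omega) (f.erase a) g (coeffBd_succ_erase hf) hg _).bind ?_
        rintro D hD ⟨h, h1, h2⟩
        refine .leaf _ ⟨h, h1, fun φ hφ => ?_⟩
        have := h2 φ hφ
        rwa [map_erase_eq (hD hφ).2] at this
      · rcases b with _ | b
        · rw [coeffBd_zero hg]
          refine .leaf _ ⟨f, Or.inr ⟨a, hf, fun φ hφ => hφ.2⟩, fun φ _ d => by simp⟩
        · refine .split _ (g.coeff b) ?_ ?_
          · refine (ih (a + 1) b (by omega) f (g.erase b) hf (coeffBd_succ_erase hg) _).bind ?_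
            rintro D hD ⟨h, h1, h2⟩
            refine .leaf _ ⟨h, h1, fun φ hφ => ?_⟩
            have := h2 φ hφ
            rwa [map_erase_eq (hD hφ).2] at this
          · refine (ih a (b + 1) (by omega) _ g (coeffBd_cancel hf hg (by omega)) hg _).bind ?_
            rintro D hD ⟨h, h1, h2⟩
            refine .leaf _ ⟨h, h1, fun φ hφ => ?_⟩
            have := h2 φ hφ
            simp only [Polynomial.map_sub, Polynomial.map_mul, Polynomial.map_C,
              ← mul_assoc] at this
            exact GcdLike.cancel (hD hφ).2 this
    intro a b hab f g hf hg C
    rcases le_total b a with h | h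
    · rcases a with _ | a
      · exact ih 0 b (by omega) f g hf hg C
      · exact key a b hab (by omega) f g hf hg C
    · rcases b with _ | b
      · exact ih a 0 (by omega) f g hf hg C
      · exact (key b a (by omega) h g f hg hf C).bind fun D _ H => .leaf _ H.symm

theorem gcd_dec' (f g : Polynomial A) (C : Set (A →+* L)) : SplitDec (GcdGood f g) C := by
  obtain ⟨a, ha⟩ := exists_coeffBd f
  obtain ⟨b, hb⟩ := exists_coeffBd g
  exact gcd_dec _ a b le_rfl f g ha hb C

theorem nvan_one_of_empty {D : Set (A →+* L)} (h : ∀ φ, φ ∉ D) : NVan D (1 : Polynomial A) 0 :=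
  ⟨fun m hm => by rw [Polynomial.coeff_one, if_neg (by omega)], fun φ hφ => (h φ hφ).elim⟩

theorem nvan_one {D : Set (A →+* L)} : NVan D (1 : Polynomial A) 0 :=
  ⟨fun m hm => by rw [Polynomial.coeff_one, if_neg (by omega)], fun φ hφ => by simp⟩

theorem gcd_dec_nz (f g : Polynomial A) (C : Set (A →+* L)) (hf : ∀ φ ∈ C, f.map φ ≠ 0) :
    SplitDec (fun D => ∃ h d, NVan D h d ∧
      ∀ φ ∈ D, GcdLike (h.map φ) (f.map φ) (g.map φ)) C := by
  refine (gcd_dec' f g C).bind ?_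
  rintro D hD ⟨h, rfl | ⟨d, hd⟩, h2⟩
  · have : ∀ φ, φ ∉ D := by
      intro φ hφ
      apply hf φ (hD hφ)
      have := ((h2 φ hφ) 0).1 (by simp)
      exact zero_dvd_iff.1 this.1
    exact .leaf _ ⟨1, 0, nvan_one, fun φ hφ => (this φ hφ).elim⟩
  · exact .leaf _ ⟨h, d, hd, h2⟩

theorem pseudo_div (g : Polynomial A) (d : ℕ) (hg : CoeffBd g (d + 1)) : ∀ (a : ℕ)
    (f : Polynomial A), CoeffBd f a → ∃ (q r : Polynomial A) (m : ℕ),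
      Polynomial.C (g.coeff d) ^ m * f = q * g + r ∧ CoeffBd r d := by
  intro a
  induction a with
  | zero => 
    intro f hf
    exact ⟨0, f, 0, by ring, fun m _ => hf m (Nat.zero_le m)⟩
  | succ a ih =>
    intro f hf
    by_cases had : a + 1 ≤ d
    · exact ⟨0, f, 0, by ring, fun m hm => hf m (had.trans hm)⟩
    · obtain ⟨q, r, m, h1, h2⟩ := ih _ (coeffBd_cancel hf hg (by omega))
      refine ⟨q + Polynomial.C (g.coeff d) ^ m * (Polynomial.C (f.coeff a) *
        Polynomial.X ^ (a - d)), r, m + 1, ?_, h2⟩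
      linear_combination h1

theorem div_dec (f g : Polynomial A) (d : ℕ) (C : Set (A →+* L)) (hg : NVan C g d)
    (hf : ∀ φ ∈ C, f.map φ ≠ 0) (hdvd : ∀ φ ∈ C, g.map φ ∣ f.map φ) :
    SplitDec (fun D => ∃ q e, NVan D q e ∧
      ∀ φ ∈ D, Associated (f.map φ) (q.map φ * g.map φ)) C := by
  obtain ⟨a, ha⟩ := exists_coeffBd f
  obtain ⟨q, r, m, h1, h2⟩ := pseudo_div g d hg.1 a f ha
  have hq : ∀ φ ∈ C, Polynomial.C (φ (g.coeff d)) ^ m * f.map φ = q.map φ * g.map φ := by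
    intro φ hφ
    have h3 := congrArg (Polynomial.map φ) h1
    simp only [Polynomial.map_mul, Polynomial.map_pow, Polynomial.map_C,
      Polynomial.map_add] at h3
    have hr : r.map φ = 0 := by
      by_contra hr
      have hdr : g.map φ ∣ r.map φ := by
        have : r.map φ = Polynomial.C (φ (g.coeff d)) ^ m * f.map φ - q.map φ * g.map φ := by
          rw [h3]; ring
        rw [this]
        exact dvd_sub ((hdvd φ hφ).mul_left _) (dvd_mul_left _ _)
      have h5 := Polynomial.natDegree_le_of_dvd hdr hr
      rw [hg.natDegree_map hφ] at h5
      apply Polynomial.leadingCoeff_ne_zero.2 hr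
      rw [Polynomial.leadingCoeff, Polynomial.coeff_map, h2 _ h5, map_zero]
    rw [h3, hr, add_zero]
  have hu : ∀ φ ∈ C, IsUnit (Polynomial.C (φ (g.coeff d)) ^ m) := fun φ hφ =>
    (Polynomial.isUnit_C.2 (hg.2 φ hφ).isUnit).pow m
  refine (gcd_dec_nz q 0 C ?_).bind ?_
  · intro φ hφ h0
    have := hq φ hφ
    rw [h0, zero_mul] at this
    exact mul_ne_zero (hu φ hφ).ne_zero (hf φ hφ) this
  · rintro D hD ⟨h, e, he, H⟩
    refine .leaf _ ⟨h, e, he, fun φ hφ => ?_⟩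
    have hA : Associated (q.map φ) (h.map φ) := by
      apply associated_of_dvd_dvd
      · exact (H φ hφ _).2 ⟨dvd_rfl, by simp⟩
      · exact ((H φ hφ _).1 dvd_rfl).1
    refine Associated.trans ?_ (hA.mul_right _)
    rw [← hq φ (hD hφ)]
    exact (associated_unit_mul_left _ _ (hu φ (hD hφ))).symm

theorem GcdLike.isRoot {h f g : Polynomial L} (H : GcdLike h f g) (x : L) :
    h.eval x = 0 ↔ f.eval x = 0 ∧ g.eval x = 0 := by
  have := H (Polynomial.X - Polynomial.C x)
  simpa only [Polynomial.dvd_iff_isRoot, Polynomial.IsRoot.def] using this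

theorem squarefree_quot [IsAlgClosed L] [CharZero L] {f q k : Polynomial L} (hf : f ≠ 0)
    (H : GcdLike k f (Polynomial.derivative f)) (hA : Associated f (q * k)) :
    Squarefree q ∧ ∀ x, f.eval x = 0 ↔ q.eval x = 0 := by
  have hqk : q * k ≠ 0 := fun h => hf (hA.eq_zero_iff.2 h)
  have hq : q ≠ 0 := left_ne_zero_of_mul hqk
  have hk : k ≠ 0 := right_ne_zero_of_mul hqk
  have hm : ∀ x, f.rootMultiplicity x = q.rootMultiplicity x + k.rootMultiplicity x := by
    intro x
    rw [← Polynomial.rootMultiplicity_mul hqk]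
    apply le_antisymm
    · rw [Polynomial.le_rootMultiplicity_iff hqk]
      exact (Polynomial.pow_rootMultiplicity_dvd f x).trans hA.dvd
    · rw [Polynomial.le_rootMultiplicity_iff hf]
      exact (Polynomial.pow_rootMultiplicity_dvd _ x).trans hA.symm.dvd
  have h1 : ∀ x, f.eval x = 0 → q.rootMultiplicity x = 1 := by
    intro x hx
    have hpos : 0 < f.rootMultiplicity x := (Polynomial.rootMultiplicity_pos hf).2 hx
    have hd := Polynomial.derivative_rootMultiplicity_of_root (p := f) (t := x) hx
    have hd0 : Polynomial.derivative f ≠ 0 := by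
      intro h0
      have := Polynomial.derivative_eq_zero.1 h0
      rw [Polynomial.eq_C_of_natDegree_eq_zero this] at hx hf
      simp at hx hf
      exact hf hx
    have hkx : k.rootMultiplicity x = f.rootMultiplicity x - 1 := by
      apply le_antisymm
      · rw [← hd, Polynomial.le_rootMultiplicity_iff hd0]
        exact ((H _).1 (Polynomial.pow_rootMultiplicity_dvd k x)).2
      · rw [Polynomial.le_rootMultiplicity_iff hk, H]
        refine ⟨(pow_dvd_pow _ (by omega)).trans (Polynomial.pow_rootMultiplicity_dvd f x), ?_⟩
        rw [← hd]
        exact Polynomial.pow_rootMultiplicity_dvd _ x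
    have := hm x
    omega
  have h2 : ∀ x, f.eval x = 0 ↔ q.eval x = 0 := by
    intro x
    constructor
    · intro hx
      have := (Polynomial.rootMultiplicity_pos hq (x := x)).1 (by rw [h1 x hx]; omega)
      exact this
    · intro hx
      have : 0 < q.rootMultiplicity x := (Polynomial.rootMultiplicity_pos hq).2 hx
      exact (Polynomial.rootMultiplicity_pos hf).1 (by rw [hm x]; omega)
  refine ⟨?_, h2⟩
  apply Polynomial.Separable.squarefree
  rw [← Polynomial.nodup_roots_iff_of_splits hq (IsAlgClosed.splits q)]
  classical
  rw [Multiset.nodup_iff_count_le_one]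
  intro x
  rw [Polynomial.count_roots]
  by_cases hx : f.eval x = 0
  · rw [h1 x hx]
  · rw [Polynomial.rootMultiplicity_eq_zero]
    · omega
    · exact fun h => hx ((h2 x).2 h)

theorem sqfree_dec [IsAlgClosed L] [CharZero L] (f : Polynomial A) (C : Set (A →+* L))
    (hf : ∀ φ ∈ C, f.map φ ≠ 0) :
    SplitDec (fun D => ∃ q e, NVan D q e ∧ ∀ φ ∈ D, Squarefree (q.map φ) ∧
      ∀ x, (f.map φ).eval x = 0 ↔ (q.map φ).eval x = 0) C := by
  refine (gcd_dec_nz f (Polynomial.derivative f) C hf).bind ?_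
  rintro D hD ⟨k, e, hk, H⟩
  refine (div_dec f k e D hk (fun φ hφ => hf φ (hD hφ))
    (fun φ hφ => ((H φ hφ _).1 dvd_rfl).1)).bind ?_
  rintro D' hD' ⟨q, e', hq, HA⟩
  refine .leaf _ ⟨q, e', hq, fun φ hφ => ?_⟩
  have h3 := H φ (hD' hφ)
  rw [← Polynomial.derivative_map] at h3
  exact squarefree_quot (hf φ (hD (hD' hφ))) h3 (HA φ hφ)

/-- the final normal form over a piece -/
def FinalGood (Q : (A →+* L) → L → Prop) (D : Set (A →+* L)) : Prop :=
  ∃ (q : Polynomial A) (e : ℕ), NVan D q e ∧ (∀ φ ∈ D, Squarefree (q.map φ)) ∧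
    ((∀ φ ∈ D, ∀ x, Q φ x ↔ (q.map φ).eval x = 0) ∨
     (∀ φ ∈ D, ∀ x, Q φ x ↔ (q.map φ).eval x ≠ 0))

theorem eqs_dec (E : List (Polynomial A)) (C : Set (A →+* L)) :
    SplitDec (fun D => ∃ g : Polynomial A, (g = 0 ∨ ∃ d, NVan D g d) ∧
      ∀ φ ∈ D, ∀ x, (∀ p ∈ E, (p.map φ).eval x = 0) ↔ (g.map φ).eval x = 0) C := by
  induction E with
  | nil => exact .leaf _ ⟨0, Or.inl rfl, by simp⟩
  | cons p E ih =>
    refine ih.bind ?_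
    rintro D hD ⟨g, -, h2⟩
    refine (gcd_dec' p g D).bind ?_
    rintro D' hD' ⟨h, h3, h4⟩
    refine .leaf _ ⟨h, h3, fun φ hφ x => ?_⟩
    rw [(h4 φ hφ).isRoot x, ← h2 φ (hD' hφ) x]
    simp

theorem final_dec [IsAlgClosed L] [CharZero L] (E N : List (Polynomial A)) (C : Set (A →+* L)) :
    SplitDec (FinalGood (fun φ x => (∀ p ∈ E, (p.map φ).eval x = 0) ∧
      ∀ p ∈ N, (p.map φ).eval x ≠ 0)) C := by
  have hN : ∀ (φ : A →+* L) (x : L), (∀ p ∈ N, (p.map φ).eval x ≠ 0) ↔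
      (N.prod.map φ).eval x ≠ 0 := by
    intro φ x
    induction N with
    | nil => simp
    | cons p N ih =>
      simp only [List.mem_cons, forall_eq_or_imp, ih, List.prod_cons, Polynomial.map_mul,
        Polynomial.eval_mul, mul_ne_zero_iff]
  simp only [hN]
  generalize N.prod = h
  refine (eqs_dec E C).bind ?_
  rintro D - ⟨g, rfl | ⟨d, hd⟩, hg⟩
  · -- no equations
    refine (gcd_dec' h 0 D).bind ?_
    rintro D1 hD1 ⟨h', rfl | ⟨d, hd⟩, hh⟩
    · refine .leaf _ ⟨1, 0, nvan_one, by simp, Or.inl fun φ hφ x => ?_⟩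
      have := ((hh φ hφ).isRoot x).1 (by simp)
      simp [this.1]
    · have hh0 : ∀ φ ∈ D1, h.map φ ≠ 0 := by
        intro φ hφ h0
        apply hd.ne_zero hφ
        have := ((hh φ hφ) 0).2 (by simp [h0])
        exact zero_dvd_iff.1 this
      refine (sqfree_dec h D1 hh0).bind ?_
      rintro D2 hD2 ⟨q, e, hq, H⟩
      refine .leaf _ ⟨q, e, hq, fun φ hφ => (H φ hφ).1, Or.inr fun φ hφ x => ?_⟩
      beta_reduce
      rw [hg φ (hD1 (hD2 hφ)) x, ne_eq, (H φ hφ).2 x]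
      simp
  · refine (sqfree_dec g D (fun φ hφ => hd.ne_zero hφ)).bind ?_
    rintro D1 hD1 ⟨s, e, hs, Hs⟩
    refine (gcd_dec_nz s h D1 (fun φ hφ => hs.ne_zero hφ)).bind ?_
    rintro D2 hD2 ⟨k, e2, hk, Hk⟩
    refine (div_dec s k e2 D2 hk (fun φ hφ => hs.ne_zero (hD2 hφ))
      (fun φ hφ => ((Hk φ hφ _).1 dvd_rfl).1)).bind ?_
    rintro D3 hD3 ⟨q, e3, hq, Hq⟩
    refine .leaf _ ⟨q, e3, hq, fun φ hφ => ?_, Or.inl fun φ hφ x => ?_⟩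
    · exact (Hs φ (hD2 (hD3 hφ))).1.squarefree_of_dvd
        ((dvd_mul_right _ _).trans (Hq φ hφ).symm.dvd)
    · have a1 := hg φ (hD1 (hD2 (hD3 hφ))) x
      obtain ⟨a2, a3⟩ := Hs φ (hD2 (hD3 hφ))
      have a4 := (Hk φ (hD3 hφ)).isRoot x
      have a5 := Hq φ hφ
      have a6 : (s.map φ).eval x = 0 ↔ (q.map φ).eval x = 0 ∨ (k.map φ).eval x = 0 := by
        rw [← mul_eq_zero, ← Polynomial.eval_mul]
        exact (a5.dvd_iff_dvd_right (a := Polynomial.X - Polynomial.C x)).trans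
          (by simp only [Polynomial.dvd_iff_isRoot, Polynomial.IsRoot.def]) |> fun t => by
            simpa only [Polynomial.dvd_iff_isRoot, Polynomial.IsRoot.def] using t
      have a7 : ¬ ((q.map φ).eval x = 0 ∧ (k.map φ).eval x = 0) := by
        rintro ⟨b1, b2⟩
        have c1 := Polynomial.dvd_iff_isRoot.2 b1
        have c2 := Polynomial.dvd_iff_isRoot.2 b2
        exact Polynomial.not_isUnit_X_sub_C x (a2 _ ((mul_dvd_mul c1 c2).trans a5.symm.dvd))
      beta_reduce
      rw [a1, a3 x]
      tauto

end Univariate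

section Multivariate

/-- polynomials in the variables of index `< k` -/
noncomputable abbrev LowAlg (F : Type*) [Field F] (n k : ℕ) :
    Subalgebra F (MvPolynomial (Fin n) F) :=
  MvPolynomial.supported F {j : Fin n | j.val < k}

/-- evaluation of the low polynomials at a point -/
noncomputable def evLow {F : Type*} [Field F] {n : ℕ} (k : ℕ) (a : Fin n → AlgebraicClosure F) :
    LowAlg F n k →+* AlgebraicClosure F :=
  (aeval a : MvPolynomial (Fin n) F →ₐ[F] AlgebraicClosure F).toRingHom.comp
    (LowAlg F n k).val.toRingHom

theorem evLow_apply {F : Type*} [Field F] {n : ℕ} (k : ℕ) (a : Fin n → AlgebraicClosure F)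
    (c : LowAlg F n k) : evLow k a c = aeval a (c : MvPolynomial (Fin n) F) := rfl

/-- from univariate polynomials over low polynomials to multivariate ones -/
noncomputable def toMv {F : Type*} [Field F] {n : ℕ} (k : Fin n)
    (q : Polynomial (LowAlg F n k.val)) : MvPolynomial (Fin n) F :=
  q.eval₂ (LowAlg F n k.val).val.toRingHom (X k)

theorem exists_toMv {F : Type*} [Field F] {n : ℕ} (k : Fin n) (p : MvPolynomial (Fin n) F)
    (hp : ∀ j ∈ p.vars, j.val < k.val + 1) : ∃ q, toMv k q = p := by
  have h1 : p ∈ LowAlg F n (k.val + 1) := MvPolynomial.mem_supported.2 fun j hj => hp j hj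
  let Φ : Polynomial (LowAlg F n k.val) →ₐ[LowAlg F n k.val] MvPolynomial (Fin n) F :=
    Polynomial.aeval (X k)
  have h2 : LowAlg F n (k.val + 1) ≤ (Φ.restrictScalars F).range := by
    unfold LowAlg MvPolynomial.supported
    rw [Algebra.adjoin_le_iff]
    rintro _ ⟨j, hj, rfl⟩
    rcases Nat.lt_succ_iff_lt_or_eq.1 hj with h | h
    · have hX : (X j : MvPolynomial (Fin n) F) ∈ LowAlg F n k.val :=
        Algebra.subset_adjoin ⟨j, h, rfl⟩
      exact ⟨Polynomial.C ⟨X j, hX⟩, Polynomial.aeval_C _ _⟩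
    · obtain rfl : j = k := Fin.ext h
      exact ⟨Polynomial.X, Polynomial.aeval_X _⟩
  obtain ⟨q, hq⟩ := h2 h1
  exact ⟨q, hq⟩

theorem toMv_vars {F : Type*} [Field F] {n : ℕ} (k : Fin n) (q : Polynomial (LowAlg F n k.val)) :
    ∀ j ∈ (toMv k q).vars, j.val < k.val + 1 := by
  have : toMv k q ∈ LowAlg F n (k.val + 1) := by
    rw [toMv, Polynomial.eval₂_eq_sum_range]
    refine Subalgebra.sum_mem _ fun i _ => Subalgebra.mul_mem _ ?_ (Subalgebra.pow_mem _ ?_ _)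
    · exact MvPolynomial.supported_mono (s := {j : Fin n | j.val < k.val})
        (fun j (hj : j.val < k.val) => Nat.lt_succ_of_lt hj) (q.coeff i).2
    · exact Algebra.subset_adjoin ⟨k, Nat.lt_succ_self _, rfl⟩
  exact fun j hj => MvPolynomial.mem_supported.1 this hj

theorem aeval_toMv {F : Type*} [Field F] {n : ℕ} (k : Fin n) (q : Polynomial (LowAlg F n k.val))
    (a : Fin n → AlgebraicClosure F) :
    aeval a (toMv k q) = (q.map (evLow k.val a)).eval (a k) := by
  have := Polynomial.hom_eval₂ q (LowAlg F n k.val).val.toRingHom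
    (aeval a : MvPolynomial (Fin n) F →ₐ[F] AlgebraicClosure F).toRingHom (X k)
  rw [Polynomial.eval_map]
  refine this.trans ?_
  congr 1
  exact aeval_X _ _

theorem uni_low {F : Type*} [Field F] {n : ℕ} (k : Fin n) (c : LowAlg F n k.val)
    (a : Fin n → AlgebraicClosure F) :
    uni a k (c : MvPolynomial (Fin n) F) = Polynomial.C (evLow k.val a c) := by
  have := MvPolynomial.hom_congr_vars
    (f₁ := (aeval (fun i => if i = k then (Polynomial.X : Polynomial (AlgebraicClosure F))
      else Polynomial.C (a i)) :
        MvPolynomial (Fin n) F →ₐ[F] Polynomial (AlgebraicClosure F)).toRingHom)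
    (f₂ := (Polynomial.C : AlgebraicClosure F →+* _).comp
      (aeval a : MvPolynomial (Fin n) F →ₐ[F] AlgebraicClosure F).toRingHom)
    (p₁ := (c : MvPolynomial (Fin n) F)) (p₂ := c) ?_ ?_ rfl
  · exact this
  · ext x : 1
    simp [Polynomial.algebraMap_apply]
  · intro i hi _
    have : i.val < k.val := MvPolynomial.mem_supported.1 c.2 hi
    have hik : i ≠ k := fun h => by simp [h] at this
    simp [hik]

theorem uni_toMv {F : Type*} [Field F] {n : ℕ} (k : Fin n) (q : Polynomial (LowAlg F n k.val))
    (a : Fin n → AlgebraicClosure F) :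
    uni a k (toMv k q) = q.map (evLow k.val a) := by
  have h := Polynomial.hom_eval₂ q (LowAlg F n k.val).val.toRingHom
    ((aeval (fun i => if i = k then (Polynomial.X : Polynomial (AlgebraicClosure F))
      else Polynomial.C (a i)) :
        MvPolynomial (Fin n) F →ₐ[F] Polynomial (AlgebraicClosure F)).toRingHom) (X k)
  refine h.trans ?_
  rw [← Polynomial.eval₂_C_X (p := q.map (evLow k.val a)), Polynomial.eval₂_map]
  congr 1
  · ext1 c
    exact uni_low k c a
  · exact (aeval_X _ _).trans (by simp)

theorem degreeOf_toMv {F : Type*} [Field F] {n : ℕ} (k : Fin n)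
    (q : Polynomial (LowAlg F n k.val)) (e : ℕ) (he : CoeffBd q (e + 1)) :
    (toMv k q).degreeOf k ≤ e := by
  have hd : q.natDegree < e + 1 := by
    rw [Nat.lt_succ_iff, Polynomial.natDegree_le_iff_coeff_eq_zero]
    exact fun m hm => he m hm
  rw [toMv, Polynomial.eval₂_eq_sum_range' _ hd]
  refine (degreeOf_sum_le _ _ _).trans (Finset.sup_le fun i hi => ?_)
  refine (degreeOf_mul_le _ _ _).trans ?_
  have h0 : degreeOf k ((LowAlg F n k.val).val.toRingHom (q.coeff i)) = 0 := by
    by_contra h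
    have h1 := MvPolynomial.mem_vars_iff_degreeOf_ne_zero.2 h
    have : k.val < k.val := MvPolynomial.mem_supported.1 (q.coeff i).2 h1
    omega
  rw [h0, degreeOf_X_self_pow]
  have := Finset.mem_range.1 hi
  omega

theorem uni_eq_sum {F : Type*} [Field F] {n : ℕ} (p : MvPolynomial (Fin n) F) (k : Fin n)
    (a : Fin n → AlgebraicClosure F) :
    uni a k p = ∑ m ∈ p.support, Polynomial.C (aeval a (monomial (m.erase k) (coeff m p)))
      * Polynomial.X ^ (m k) := by
  unfold uni
  conv_lhs => rw [p.as_sum]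
  rw [map_sum]
  refine Finset.sum_congr rfl fun m _ => ?_
  rw [aeval_monomial, aeval_monomial, Finsupp.prod_fintype _ _ (by simp),
    Finsupp.prod_fintype _ _ (by simp), ← Finset.mul_prod_erase _ _ (Finset.mem_univ k),
    ← Finset.mul_prod_erase (a := k) _ (fun i => a i ^ (m.erase k) i) (Finset.mem_univ k)]
  have h2 : ∀ i ∈ Finset.univ.erase k,
      (if i = k then (Polynomial.X : Polynomial (AlgebraicClosure F))
        else Polynomial.C (a i)) ^ m i = Polynomial.C (a i ^ (m.erase k) i) := by
    intro i hi
    have hik := Finset.ne_of_mem_erase hi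
    rw [if_neg hik, Finsupp.erase_ne hik, Polynomial.C_pow]
  rw [Finset.prod_congr rfl h2]
  simp only [if_true, Finsupp.erase_same, pow_zero, one_mul, map_mul, map_prod,
    Polynomial.algebraMap_apply]
  ring

theorem aeval_initOf {F : Type*} [Field F] {n : ℕ} (p : MvPolynomial (Fin n) F) (k : Fin n)
    (a : Fin n → AlgebraicClosure F) :
    aeval a (initOf p k) = (uni a k p).coeff (p.degreeOf k) := by
  rw [uni_eq_sum, Polynomial.finsetSum_coeff, initOf, map_sum, Finset.sum_filter]
  refine Finset.sum_congr rfl fun m _ => ?_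
  rw [Polynomial.coeff_C_mul_X_pow]
  simp only [eq_comm]

theorem aeval_congr_vars {F : Type*} [Field F] {n : ℕ} (p : MvPolynomial (Fin n) F)
    (hp : ∀ j, j ∉ p.vars) (a b : Fin n → AlgebraicClosure F) : aeval a p = aeval b p := by
  exact MvPolynomial.hom_congr_vars
    (f₁ := (aeval a : MvPolynomial (Fin n) F →ₐ[F] AlgebraicClosure F).toRingHom)
    (f₂ := (aeval b : MvPolynomial (Fin n) F →ₐ[F] AlgebraicClosure F).toRingHom)
    (by ext x; simp) (fun i hi => (hp i hi).elim) rfl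

/-- all members of `S` only involve variables of index `< k` -/
def BelowSys {F : Type*} [Field F] {n : ℕ} (k : ℕ) (S : AlgSystem F n) : Prop :=
  ∀ p, S.Mem p → ∀ j ∈ p.vars, j.val < k

/-- existence of a Thomas decomposition, by systems in the variables of index `< k` -/
def TDec {F : Type*} [Field F] {n : ℕ} (k : ℕ)
    (Q : (Fin n → AlgebraicClosure F) → Prop) : Prop :=
  ∃ l : List (AlgSystem F n), (∀ T ∈ l, Simple T ∧ BelowSys k T) ∧
    (∀ a, Q a ↔ ∃ T ∈ l, Sol T a) ∧
    l.Pairwise (fun T U => ∀ a, ¬ (Sol T a ∧ Sol U a))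

theorem TDec.congr {F : Type*} [Field F] {n k : ℕ} {Q Q' : (Fin n → AlgebraicClosure F) → Prop}
    (h : TDec k Q) (hQ : ∀ a, Q a ↔ Q' a) : TDec k Q' := by
  obtain rfl : Q = Q' := funext fun a => propext (hQ a)
  exact h

theorem TDec.empty {F : Type*} [Field F] {n k : ℕ} {Q : (Fin n → AlgebraicClosure F) → Prop}
    (h : ∀ a, ¬ Q a) : TDec k Q :=
  ⟨[], by simp, by simpa using h, List.Pairwise.nil⟩

theorem TDec.single {F : Type*} [Field F] {n k : ℕ} {Q : (Fin n → AlgebraicClosure F) → Prop}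
    (T : AlgSystem F n) (h1 : Simple T) (h2 : BelowSys k T) (h : ∀ a, Q a ↔ Sol T a) : TDec k Q :=
  ⟨[T], by simp [h1, h2], by simpa using h, List.pairwise_singleton _ _⟩

theorem TDec.or {F : Type*} [Field F] {n k : ℕ} {Q Q' : (Fin n → AlgebraicClosure F) → Prop}
    (h : TDec k Q) (h' : TDec k Q') (hd : ∀ a, ¬ (Q a ∧ Q' a)) :
    TDec k (fun a => Q a ∨ Q' a) := by
  obtain ⟨l, h1, h2, h3⟩ := h
  obtain ⟨l', h1', h2', h3'⟩ := h'
  refine ⟨l ++ l', ?_, ?_, ?_⟩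
  · intro T hT
    rcases List.mem_append.1 hT with h | h
    · exact h1 T h
    · exact h1' T h
  · intro a
    simp only [h2, h2', List.mem_append, or_and_right, exists_or]
  · refine List.pairwise_append.2 ⟨h3, h3', fun T hT U hU a ha => hd a ?_⟩
    exact ⟨(h2 a).2 ⟨T, hT, ha.1⟩, (h2' a).2 ⟨U, hU, ha.2⟩⟩

theorem TDec.list {F : Type*} [Field F] {n k : ℕ} {Q : (Fin n → AlgebraicClosure F) → Prop}
    (l : List (AlgSystem F n)) (hl : l.Pairwise (fun T U => ∀ a, ¬ (Sol T a ∧ Sol U a)))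
    (h : ∀ T ∈ l, TDec k (fun a => Sol T a ∧ Q a)) :
    TDec k (fun a => (∃ T ∈ l, Sol T a) ∧ Q a) := by
  induction l with
  | nil => exact TDec.empty (by simp)
  | cons T l ih =>
    rw [List.pairwise_cons] at hl
    have := (h T (by simp)).or (ih hl.2 fun U hU => h U (by simp [hU])) (by
      rintro a ⟨h1, ⟨U, hU, h2⟩, _⟩
      exact hl.1 U hU a ⟨h1.1, h2⟩)
    refine this.congr fun a => ?_
    simp only [List.mem_cons, exists_eq_or_imp]
    tauto

theorem solBelow_iff {F : Type*} [Field F] {n : ℕ} {k : Fin n} {T : AlgSystem F n}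
    (hT : BelowSys k.val T) (a : Fin n → AlgebraicClosure F) : SolBelow T k a ↔ Sol T a := by
  constructor
  · exact fun h => ⟨fun p hp => h.1 p hp (hT p (Or.inl hp)), fun p hp => h.2 p hp (hT p (Or.inr hp))⟩
  · exact fun h => ⟨fun p hp _ => h.1 p hp, fun p hp _ => h.2 p hp⟩

theorem simple_insert {F : Type*} [Field F] {n : ℕ} {k : Fin n} {T T' : AlgSystem F n}
    {p : MvPolynomial (Fin n) F} (hT : Simple T) (hB : BelowSys k.val T) (hp : IsLeader p k)
    (hE : ∀ r, r ≠ p → (r ∈ T'.eqs ↔ r ∈ T.eqs)) (hN : ∀ r, r ≠ p → (r ∈ T'.ineqs ↔ r ∈ T.ineqs))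
    (hnb : ¬ (p ∈ T'.eqs ∧ p ∈ T'.ineqs))
    (hi : ∀ a, Sol T a → aeval a (initOf p k) ≠ 0) (hs : ∀ a, Sol T a → Squarefree (uni a k p)) :
    Simple T' := by
  have hM : ∀ r, T'.Mem r → r = p ∨ T.Mem r := by
    intro r hr
    by_cases h : r = p
    · exact Or.inl h
    · exact Or.inr (hr.imp (hE r h).1 (hN r h).1)
  have hpT : ¬ T.Mem p := fun h => by
    have : k.val < k.val := hB p h k hp.1
    omega
  have hne : ∀ r, T.Mem r → r ≠ p := fun r hr h => hpT (h ▸ hr)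
  have hlead : ∀ r, T.Mem r → ∀ i, IsLeader r i → i < k := fun r hr i h => hB r hr i h.1
  have hlp : ∀ i, IsLeader p i → i = k := fun i h =>
    le_antisymm (hp.2 i h.1) (h.2 k hp.1)
  have hsol : ∀ i, i ≤ k → ∀ a, SolBelow T' i a → SolBelow T i a := by
    intro i _ a h
    constructor
    · intro r hr hv
      exact h.1 r ((hE r (hne r (Or.inl hr))).2 hr) hv
    · intro r hr hv
      exact h.2 r ((hN r (hne r (Or.inr hr))).2 hr) hv
  refine ⟨⟨?_, ?_, ?_⟩, ?_, ?_⟩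
  · intro i r hr s hs' h1 h2
    rcases hM r hr with rfl | hr' <;> rcases hM s hs' with rfl | hs''
    · rfl
    · have := hlead s hs'' i h2
      have := hlp i h1
      omega
    · have := hlead r hr' i h1
      have := hlp i h2
      omega
    · exact hT.1.1 i r hr' s hs'' h1 h2
  · intro i r h1 h2
    by_cases h : r = p
    · exact hnb (h ▸ h2)
    · exact hT.1.2.1 i r h1 ⟨(hE r h).1 h2.1, (hN r h).1 h2.2⟩
  · intro r hr
    rcases hM r hr with rfl | hr'
    · exact ⟨k, hp.1⟩
    · exact hT.1.2.2 r hr'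
  · intro i r hr h1 a ha
    rcases hM r hr with rfl | hr'
    · obtain rfl := hlp i h1
      exact hi a ((solBelow_iff hB a).1 (hsol _ le_rfl a ha))
    · exact hT.2.1 i r hr' h1 a (hsol i (hlead r hr' i h1).le a ha)
  · intro i r hr h1 a ha
    rcases hM r hr with rfl | hr'
    · obtain rfl := hlp i h1
      exact hs a ((solBelow_iff hB a).1 (hsol _ le_rfl a ha))
    · exact hT.2.2 i r hr' h1 a (hsol i (hlead r hr' i h1).le a ha)

/-- add an equation -/
noncomputable def addEq {F : Type*} [Field F] {n : ℕ} (T : AlgSystem F n)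
    (p : MvPolynomial (Fin n) F) : AlgSystem F n :=
  open Classical in ⟨insert p T.eqs, T.ineqs⟩

/-- add an inequation -/
noncomputable def addNe {F : Type*} [Field F] {n : ℕ} (T : AlgSystem F n)
    (p : MvPolynomial (Fin n) F) : AlgSystem F n :=
  open Classical in ⟨T.eqs, insert p T.ineqs⟩

theorem sol_addEq {F : Type*} [Field F] {n : ℕ} (T : AlgSystem F n)
    (p : MvPolynomial (Fin n) F) (a : Fin n → AlgebraicClosure F) :
    Sol (addEq T p) a ↔ Sol T a ∧ aeval a p = 0 := by
  simp only [Sol, addEq, Finset.mem_insert, forall_eq_or_imp]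
  tauto

theorem sol_addNe {F : Type*} [Field F] {n : ℕ} (T : AlgSystem F n)
    (p : MvPolynomial (Fin n) F) (a : Fin n → AlgebraicClosure F) :
    Sol (addNe T p) a ↔ Sol T a ∧ aeval a p ≠ 0 := by
  simp only [Sol, addNe, Finset.mem_insert, forall_eq_or_imp]
  tauto

theorem belowSys_addEq {F : Type*} [Field F] {n k : ℕ} {T : AlgSystem F n}
    {p : MvPolynomial (Fin n) F} (hT : BelowSys k T) (hp : ∀ j ∈ p.vars, j.val < k) :
    BelowSys k (addEq T p) := by
  intro r hr
  simp only [AlgSystem.Mem, addEq, Finset.mem_insert] at hr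
  rcases hr with (rfl | h) | h
  · exact hp
  · exact hT r (Or.inl h)
  · exact hT r (Or.inr h)

theorem belowSys_addNe {F : Type*} [Field F] {n k : ℕ} {T : AlgSystem F n}
    {p : MvPolynomial (Fin n) F} (hT : BelowSys k T) (hp : ∀ j ∈ p.vars, j.val < k) :
    BelowSys k (addNe T p) := by
  intro r hr
  simp only [AlgSystem.Mem, addNe, Finset.mem_insert] at hr
  rcases hr with h | rfl | h
  · exact hT r (Or.inl h)
  · exact hp
  · exact hT r (Or.inr h)

theorem BelowSys.mono {F : Type*} [Field F] {n k l : ℕ} {T : AlgSystem F n}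
    (hT : BelowSys k T) (h : k ≤ l) : BelowSys l T :=
  fun r hr j hj => (hT r hr j hj).trans_le h

/-- one simple base system together with one polynomial in normal form over it -/
theorem tdec_leaf {F : Type*} [Field F] {n : ℕ} (k : Fin n)
    (T : AlgSystem F n) (hT : Simple T) (hB : BelowSys k.val T)
    (Q : (LowAlg F n k.val →+* AlgebraicClosure F) → AlgebraicClosure F → Prop)
    (D : Set (LowAlg F n k.val →+* AlgebraicClosure F)) (hD : ∀ a, Sol T a → evLow k.val a ∈ D)
    (H : FinalGood Q D) :
    TDec (k.val + 1) (fun a => Sol T a ∧ Q (evLow k.val a) (a k)) := by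
  by_cases hne : ∃ a, Sol T a
  swap
  · exact TDec.empty fun a h => hne ⟨a, h.1⟩
  obtain ⟨a₀, ha₀⟩ := hne
  obtain ⟨q, e, hq, hsf, hQ⟩ := H
  rcases Nat.eq_zero_or_pos e with rfl | he
  · have hc : ∀ a, Sol T a → (q.map (evLow k.val a)).eval (a k) ≠ 0 := by
      intro a ha h0
      have h1 := Polynomial.eq_C_of_natDegree_eq_zero (hq.natDegree_map (hD a ha))
      have h2 := hq.ne_zero (hD a ha)
      rw [h1, Polynomial.eval_C] at h0
      rw [h1, h0, map_zero] at h2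
      exact h2 rfl
    rcases hQ with hQ | hQ
    · exact TDec.empty fun a h => hc a h.1 ((hQ _ (hD a h.1) _).1 h.2)
    · refine TDec.single T hT (hB.mono (Nat.le_succ _)) fun a => ?_
      exact ⟨fun h => h.1, fun h => ⟨h, (hQ _ (hD a h) _).2 (hc a h)⟩⟩
  · have hv := toMv_vars k q
    have hdeg : ∀ a, Sol T a → (uni a k (toMv k q)).coeff e ≠ 0 := by
      intro a ha
      rw [uni_toMv, Polynomial.coeff_map]
      exact hq.2 _ (hD a ha)
    have hdo : (toMv k q).degreeOf k = e := by
      refine le_antisymm (degreeOf_toMv k q e hq.1) ?_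
      by_contra hlt
      push Not at hlt
      have h1 := hdeg a₀ ha₀
      apply h1
      rw [uni_eq_sum, Polynomial.finsetSum_coeff]
      refine Finset.sum_eq_zero fun m hm => ?_
      have := MvPolynomial.monomial_le_degreeOf k hm
      rw [Polynomial.coeff_C_mul_X_pow, if_neg (by omega)]
    have hL : IsLeader (toMv k q) k := by
      refine ⟨?_, fun j hj => Nat.lt_succ_iff.1 (hv j hj)⟩
      rw [MvPolynomial.mem_vars_iff_degreeOf_ne_zero, hdo]
      omega
    have hi : ∀ a, Sol T a → aeval a (initOf (toMv k q) k) ≠ 0 := by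
      intro a ha
      rw [aeval_initOf, hdo]
      exact hdeg a ha
    have hs : ∀ a, Sol T a → Squarefree (uni a k (toMv k q)) := by
      intro a ha
      rw [uni_toMv]
      exact hsf _ (hD a ha)
    have hpT : ¬ T.Mem (toMv k q) := fun h => by
      have : k.val < k.val := hB _ h k hL.1
      omega
    rcases hQ with hQ | hQ
    · refine TDec.single (addEq T (toMv k q)) ?_ (belowSys_addEq (hB.mono (Nat.le_succ _)) hv) ?_
      · refine simple_insert hT hB hL ?_ ?_ ?_ hi hs
        · intro r hr; simp [addEq, hr]
        · intro r hr; simp [addEq]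
        · exact fun h => hpT (Or.inr h.2)
      · intro a
        rw [sol_addEq, aeval_toMv]
        exact and_congr_right fun h => hQ _ (hD a h) _
    · refine TDec.single (addNe T (toMv k q)) ?_ (belowSys_addNe (hB.mono (Nat.le_succ _)) hv) ?_
      · refine simple_insert hT hB hL ?_ ?_ ?_ hi hs
        · intro r hr; simp [addNe]
        · intro r hr; simp [addNe, hr]
        · exact fun h => hpT (Or.inl h.1)
      · intro a
        rw [sol_addNe, aeval_toMv]
        exact and_congr_right fun h => hQ _ (hD a h) _

theorem tdec_split {F : Type*} [Field F] {n : ℕ} (k : Fin n)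
    (ih : ∀ S : AlgSystem F n, BelowSys k.val S → TDec k.val (Sol S))
    (Q : (LowAlg F n k.val →+* AlgebraicClosure F) → AlgebraicClosure F → Prop)
    (D : Set (LowAlg F n k.val →+* AlgebraicClosure F)) (H : SplitDec (FinalGood Q) D) :
    ∀ B : AlgSystem F n, BelowSys k.val B → (∀ a, Sol B a ↔ evLow k.val a ∈ D) →
      TDec (k.val + 1) (fun a => Sol B a ∧ Q (evLow k.val a) (a k)) := by
  induction H with
  | leaf D hD =>
    intro B hB hBD
    obtain ⟨l, h1, h2, h3⟩ := ih B hB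
    refine (TDec.list l h3 (Q := fun a => Q (evLow k.val a) (a k)) fun T hT => ?_).congr
      fun a => and_congr_left' (h2 a).symm
    exact tdec_leaf k T (h1 T hT).1 (h1 T hT).2 Q D
      (fun a ha => (hBD a).1 ((h2 a).2 ⟨T, hT, ha⟩)) hD
  | split D f _ _ ih1 ih2 =>
    intro B hB hBD
    have hf : ∀ j ∈ (f : MvPolynomial (Fin n) F).vars, j.val < k.val :=
      fun j hj => MvPolynomial.mem_supported.1 f.2 hj
    have t1 := ih1 (addEq B f) (belowSys_addEq hB hf) (fun a => by
      rw [sol_addEq, hBD]; rfl)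
    have t2 := ih2 (addNe B f) (belowSys_addNe hB hf) (fun a => by
      rw [sol_addNe, hBD]; rfl)
    refine (t1.or t2 ?_).congr ?_
    · intro a h
      rw [sol_addEq, sol_addNe] at h
      exact h.2.1.2 h.1.1.2
    · intro a
      rw [sol_addEq, sol_addNe]
      tauto

theorem tdec_all {F : Type*} [Field F] [CharZero F] {n : ℕ} : ∀ k : ℕ, k ≤ n →
    ∀ S : AlgSystem F n, BelowSys k S → TDec k (Sol S) := by
  intro k
  induction k with
  | zero =>
    intro _ S hS
    have hc : ∀ a b, Sol S a → Sol S b := by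
      intro a b h
      constructor
      · intro p hp
        rw [← h.1 p hp]
        exact aeval_congr_vars p (fun j hj => absurd (hS p (Or.inl hp) j hj) (by omega)) b a
      · intro p hp
        rw [aeval_congr_vars p (fun j hj => absurd (hS p (Or.inr hp) j hj) (by omega)) b a]
        exact h.2 p hp
    by_cases h : ∃ a, Sol S a
    · obtain ⟨a, ha⟩ := h
      refine TDec.single ⟨∅, ∅⟩ ?_ ?_ ?_
      · simp [Simple, Triangular, NonVanishingInitials, SquarefreeCond, AlgSystem.Mem]
      · simp [BelowSys, AlgSystem.Mem]
      · intro b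
        simp [Sol]
        exact hc a b ha
    · exact TDec.empty fun a ha => h ⟨a, ha⟩
  | succ k ih =>
    intro hk S hS
    obtain ⟨K, rfl⟩ : ∃ K : Fin n, K.val = k := ⟨⟨k, by omega⟩, rfl⟩
    have hlift : ∀ p : MvPolynomial (Fin n) F, ∃ q, S.Mem p → toMv K q = p := by
      intro p
      by_cases h : S.Mem p
      · obtain ⟨q, hq⟩ := exists_toMv K p (hS p h)
        exact ⟨q, fun _ => hq⟩
      · exact ⟨0, fun h' => (h h').elim⟩
    choose lift hl using hlift
    have := tdec_split K (ih (by omega)) _ _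
      (final_dec (S.eqs.toList.map lift) (S.ineqs.toList.map lift)
        (Set.univ : Set (LowAlg F n K.val →+* AlgebraicClosure F))) ⟨∅, ∅⟩
      (by simp [BelowSys, AlgSystem.Mem]) (by simp [Sol])
    refine this.congr fun a => ?_
    have e1 : ∀ p, S.Mem p →
        ((lift p).map (evLow K.val a)).eval (a K) = aeval a p := by
      intro p hp
      rw [← aeval_toMv, hl p hp]
    simp only [List.mem_map, Finset.mem_toList, forall_exists_index, and_imp,
      forall_apply_eq_imp_iff₂]
    constructor
    · rintro ⟨-, h1, h2⟩
      exact ⟨fun p hp => (e1 p (Or.inl hp)) ▸ h1 p hp, fun p hp => (e1 p (Or.inr hp)) ▸ h2 p hp⟩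
    · rintro ⟨h1, h2⟩
      refine ⟨by simp [Sol], fun p hp => ?_, fun p hp => ?_⟩
      · rw [e1 p (Or.inl hp)]; exact h1 p hp
      · rw [e1 p (Or.inr hp)]; exact h2 p hp

end Multivariate

/-- **Existence of a Thomas decomposition.** Every algebraic system `S` over
`F[x₁,…,xₙ]` admits finitely many simple systems `S₁,…,Sₘ` whose solution sets
partition `Sol(S)`: their union is `Sol(S)` and they are pairwise disjoint. -/
theorem exists_thomas_decomposition (S : AlgSystem F n) :
    ∃ (m : ℕ) (T : Fin m → AlgSystem F n),
      (∀ i, Simple (T i)) ∧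
      (∀ a : Fin n → AlgebraicClosure F, Sol S a ↔ ∃ i, Sol (T i) a) ∧
      (∀ i j, i ≠ j → ∀ a : Fin n → AlgebraicClosure F, ¬(Sol (T i) a ∧ Sol (T j) a)) := by
  obtain ⟨l, h1, h2, h3⟩ := tdec_all n le_rfl S (fun p _ j _ => j.isLt)
  refine ⟨l.length, l.get, fun i => (h1 _ (List.get_mem l i)).1, fun a => ?_, ?_⟩
  · rw [h2 a]
    constructor
    · rintro ⟨T, hT, hs⟩
      obtain ⟨i, rfl⟩ := List.get_of_mem hT
      exact ⟨i, hs⟩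
    · rintro ⟨i, hs⟩
      exact ⟨_, List.get_mem l i, hs⟩
  · intro i j hij a h
    rw [List.pairwise_iff_get] at h3
    rcases lt_or_gt_of_ne hij with hlt | hlt
    · exact h3 i j hlt a h
    · exact h3 j i hlt a h.symm
end

section
/- Every simple system S over R = F[x₁,…,x_n] has a solution: Sol(S) ≠ ∅. -/
open MvPolynomial

variable {F : Type*} [Field F] [CharZero F] {n : ℕ}

/-- Evaluating the univariate specialization. -/
lemma eval_uni (a : Fin n → AlgebraicClosure F) (k : Fin n) (p : MvPolynomial (Fin n) F)
    (t : AlgebraicClosure F) :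
    (uni a k p).eval t = aeval (Function.update a k t) p := by
  classical
  unfold uni
  rw [aeval_def, aeval_def, eval₂_eq', eval₂_eq', Polynomial.eval_finsetSum]
  refine Finset.sum_congr rfl fun m _ => ?_
  rw [Polynomial.eval_mul, Polynomial.eval_prod]
  congr 1
  · simp [Polynomial.algebraMap_apply]
  · refine Finset.prod_congr rfl fun i _ => ?_
    by_cases h : i = k
    · subst h; simp
    · simp [h]

/-- The coefficient of the specialization at the main degree is the specialized initial. -/
lemma coeff_uni (a : Fin n → AlgebraicClosure F) (k : Fin n) (p : MvPolynomial (Fin n) F) :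
    (uni a k p).coeff (p.degreeOf k) = aeval a (initOf p k) := by
  classical
  unfold uni initOf
  rw [aeval_def, eval₂_eq', Polynomial.finsetSum_coeff, map_sum, Finset.sum_filter]
  refine Finset.sum_congr rfl fun m _ => ?_
  have h1 : (∏ i, (if i = k then (Polynomial.X : Polynomial (AlgebraicClosure F))
      else Polynomial.C (a i)) ^ m i) =
      Polynomial.X ^ m k * Polynomial.C (∏ i ∈ Finset.univ.erase k, a i ^ m i) := by
    rw [← Finset.mul_prod_erase Finset.univ _ (Finset.mem_univ k), if_pos rfl, map_prod]
    congr 1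
    refine Finset.prod_congr rfl fun i hi => ?_
    rw [if_neg (Finset.ne_of_mem_erase hi), map_pow]
  have h2 : (∏ i, a i ^ (m.erase k) i) = ∏ i ∈ Finset.univ.erase k, a i ^ m i := by
    rw [← Finset.mul_prod_erase Finset.univ _ (Finset.mem_univ k)]
    rw [Finsupp.erase_same, pow_zero, one_mul]
    refine Finset.prod_congr rfl fun i hi => ?_
    rw [Finsupp.erase_ne (Finset.ne_of_mem_erase hi)]
  have h3 : (algebraMap F (Polynomial (AlgebraicClosure F))) (coeff m p) =
      Polynomial.C (algebraMap F (AlgebraicClosure F) (coeff m p)) := rfl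
  rw [h1, h3, Polynomial.coeff_C_mul, Polynomial.coeff_mul_C, Polynomial.coeff_X_pow]
  by_cases h : m k = p.degreeOf k
  · rw [if_pos h.symm, if_pos h, aeval_monomial, Finsupp.prod_fintype _ _ (by simp), h2, one_mul]
  · rw [if_neg (Ne.symm h), if_neg h]; simp

/-- Evaluation depends only on the occurring variables. -/
lemma aeval_update_eq (a : Fin n → AlgebraicClosure F) (k : Fin n) (p : MvPolynomial (Fin n) F)
    (t : AlgebraicClosure F) (h : k ∉ p.vars) :
    aeval (Function.update a k t) p = aeval a p := by
  rw [aeval_def, aeval_def]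
  refine eval₂Hom_congr' (f₁ := algebraMap F _) rfl (fun i hi _ => ?_) rfl
  rw [Function.update_of_ne]
  rintro rfl
  exact h hi

/-- **Every simple system has a solution.** -/
theorem simple_system_has_solution (S : AlgSystem F n) (hS : Simple S) :
    ∃ a : Fin n → AlgebraicClosure F, Sol S a := by
  classical
  obtain ⟨⟨huniq, hdisj, hne⟩, hinit, -⟩ := hS
  have key : ∀ m : ℕ, m ≤ n → ∃ a : Fin n → AlgebraicClosure F,
      (∀ p ∈ S.eqs, (∀ j ∈ p.vars, j.val < m) → aeval a p = 0) ∧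
      (∀ p ∈ S.ineqs, (∀ j ∈ p.vars, j.val < m) → aeval a p ≠ 0) := by
    intro m
    induction m with
    | zero =>
      intro _
      refine ⟨0, fun p hp h => ?_, fun p hp h => ?_⟩
      · obtain ⟨j, hj⟩ := hne p (Or.inl hp)
        exact absurd (h j hj) (Nat.not_lt_zero _)
      · obtain ⟨j, hj⟩ := hne p (Or.inr hp)
        exact absurd (h j hj) (Nat.not_lt_zero _)
    | succ m ih =>
      intro hm
      obtain ⟨a, ha1, ha2⟩ := ih (by omega)
      let k : Fin n := ⟨m, hm⟩
      have hbelow : SolBelow S k a := ⟨ha1, ha2⟩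
      have hlead : ∀ p : MvPolynomial (Fin n) F, (∀ j ∈ p.vars, j.val < m + 1) →
          k ∈ p.vars → IsLeader p k := fun p h hk =>
        ⟨hk, fun j hj => Fin.le_def.2 (Nat.lt_succ_iff.1 (h j hj))⟩
      have hlow : ∀ p : MvPolynomial (Fin n) F, (∀ j ∈ p.vars, j.val < m + 1) →
          k ∉ p.vars → ∀ j ∈ p.vars, j.val < m := by
        intro p h hk j hj
        have h1 := h j hj
        have h2 : j.val ≠ m := by
          intro e
          exact hk ((Fin.ext e : j = k) ▸ hj)
        omega
      have hcoeff : ∀ p, S.Mem p → IsLeader p k → (uni a k p).coeff (p.degreeOf k) ≠ 0 :=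
        fun p hp hl => by
          rw [coeff_uni]; exact hinit k p hp hl a hbelow
      have ht : ∃ t : AlgebraicClosure F,
          (∀ p ∈ S.eqs, IsLeader p k → (uni a k p).eval t = 0) ∧
          (∀ p ∈ S.ineqs, IsLeader p k → (uni a k p).eval t ≠ 0) := by
        by_cases hex : ∃ p, S.Mem p ∧ IsLeader p k
        · obtain ⟨p, hp, hl⟩ := hex
          have hc := hcoeff p hp hl
          rcases hp with hp | hp
          · have hd : 0 < p.degreeOf k := by
              obtain ⟨s, hs, hks⟩ := (mem_vars k).1 hl.1
              exact lt_of_lt_of_le (Nat.pos_of_ne_zero (Finsupp.mem_support_iff.1 hks))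
                (monomial_le_degreeOf k hs)
            have hdeg : (uni a k p).degree ≠ 0 := by
              intro h0
              have := Polynomial.le_degree_of_ne_zero hc
              rw [h0] at this
              have h3 : p.degreeOf k ≤ 0 := by exact_mod_cast this
              omega
            obtain ⟨t, ht⟩ := IsAlgClosed.exists_root _ hdeg
            refine ⟨t, fun q hq hql => ?_, fun q hq hql => ?_⟩
            · rw [huniq k q (Or.inl hq) p (Or.inl hp) hql hl]; exact ht
            · have e := huniq k q (Or.inr hq) p (Or.inl hp) hql hl
              exact absurd ⟨hp, e ▸ hq⟩ (hdisj k p hl)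
          · have h0 : uni a k p ≠ 0 := by
              intro h0
              rw [h0] at hc
              exact hc (Polynomial.coeff_zero _)
            obtain ⟨t, ht⟩ := Polynomial.exists_eval_ne_zero_of_natDegree_lt_card (uni a k p) h0
              (lt_of_lt_of_le (Cardinal.natCast_lt_aleph0) (Cardinal.aleph0_le_mk _))
            refine ⟨t, fun q hq hql => ?_, fun q hq hql => ?_⟩
            · have e := huniq k q (Or.inl hq) p (Or.inr hp) hql hl
              exact absurd ⟨e ▸ hq, hp⟩ (hdisj k p hl)
            · rw [huniq k q (Or.inr hq) p (Or.inr hp) hql hl]; exact ht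
        · exact ⟨0, fun p hp hl => absurd ⟨p, Or.inl hp, hl⟩ hex,
            fun p hp hl => absurd ⟨p, Or.inr hp, hl⟩ hex⟩
      obtain ⟨t, ht1, ht2⟩ := ht
      refine ⟨Function.update a k t, fun p hp h => ?_, fun p hp h => ?_⟩
      · by_cases hk : k ∈ p.vars
        · rw [← eval_uni]; exact ht1 p hp (hlead p h hk)
        · rw [aeval_update_eq _ _ _ _ hk]; exact ha1 p hp (hlow p h hk)
      · by_cases hk : k ∈ p.vars
        · rw [← eval_uni]; exact ht2 p hp (hlead p h hk)
        · rw [aeval_update_eq _ _ _ _ hk]; exact ha2 p hp (hlow p h hk)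
  obtain ⟨a, h1, h2⟩ := key n le_rfl
  exact ⟨a, fun p hp => h1 p hp fun j _ => j.2, fun p hp => h2 p hp fun j _ => j.2⟩
end

section
/- Let S be a simple system over R = F[x₁,…,x_n] with set of equations G = {g ∈ R : (g=0) ∈ S}, and let p ∈ R. Suppose there exist exponents e_g ∈ ℕ and polynomials c_g ∈ R (g ∈ G) such that (∏_{g∈G} init(g)^{e_g}) · p = ∑_{g∈G} c_g · g. Then φ_a(p) = 0 for every a ∈ Sol(S); i.e., a polynomial that pseudo-reduces to zero modulo the equations of a simple system vanishes on all solutions of the system. -/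
open MvPolynomial

variable {F : Type*} [Field F] [CharZero F] {n : ℕ}

/-- A polynomial that pseudo-reduces to zero modulo the equations of a simple
system vanishes on all solutions of the system: if
`(∏_{g ∈ G} init(g)^{e_g}) · p = ∑_{g ∈ G} c_g · g` where `G` is the set of
equations of the simple system `S`, then `φ_a(p) = 0` for every `a ∈ Sol(S)`. -/
theorem pseudo_reduces_to_zero_vanishes (S : AlgSystem F n) (hS : Simple S)
    (p : MvPolynomial (Fin n) F)
    (lead : MvPolynomial (Fin n) F → Fin n)
    (hlead : ∀ g ∈ S.eqs, IsLeader g (lead g))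
    (e : MvPolynomial (Fin n) F → ℕ)
    (c : MvPolynomial (Fin n) F → MvPolynomial (Fin n) F)
    (h : (∏ g ∈ S.eqs, (initOf g (lead g)) ^ e g) * p = ∑ g ∈ S.eqs, c g * g) :
    ∀ a : Fin n → AlgebraicClosure F, Sol S a → aeval a p = 0 := by
  intro a ha
  have hA := congrArg (aeval a) h
  rw [map_mul, map_prod, map_sum, Finset.sum_eq_zero
    (fun g hg => by rw [map_mul, ha.1 g hg, mul_zero])] at hA
  refine (mul_eq_zero.mp hA).resolve_left (Finset.prod_ne_zero_iff.mpr fun g hg => ?_)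
  rw [map_pow]
  exact pow_ne_zero _ (hS.2.1 (lead g) g (Or.inl hg) (hlead g hg) a
    ⟨fun q hq _ => ha.1 q hq, fun q hq _ => ha.2 q hq⟩)
end

section
/- Let X be a set and <₁,…,<_m transitive asymmetric relations on X such that for each i the incomparability relation (neither a <_i b nor b <_i a) is transitive. Define the composite order < = [<₁,…,<_m] by: a < b if and only if there exists i ∈ {1,…,m} with a <_i b and, for every j < i, a and b are <_j-incomparable. If each <_i is well-founded (admits no infinite strictly descending chain), then the composite order < is well-founded. -/
/-- Incomparable elements have comparable ranks. -/
theorem rank_le_of_incomp {X : Type*} (r : X → X → Prop) (htrans : Transitive r)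
    (hincomp : Transitive (fun a b : X => ¬ r a b ∧ ¬ r b a))
    (hwf : WellFounded r) (a b : X) (hab : ¬ r a b ∧ ¬ r b a) : (hwf.apply a).rank ≤ (hwf.apply b).rank := by
  rw [(hwf.apply a).rank_eq]
  refine Ordinal.iSup_le fun ⟨c, hc⟩ => ?_
  refine Order.succ_le_of_lt ((hwf.apply b).rank_lt_of_rel ?_)
  by_contra h
  by_cases h2 : r b c
  · exact hab.2 (htrans h2 hc)
  · exact (hincomp (show ¬ r c b ∧ ¬ r b c from ⟨h, h2⟩) (show ¬ r b a ∧ ¬ r a b from hab.symm)).1 hc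

/-- **Well-foundedness of the composite order.** Given transitive asymmetric
relations `<₁,…,<ₘ` on `X` whose incomparability relations are transitive, the
composite order `[<₁,…,<ₘ]` (where `a < b` iff `a <ᵢ b` for some `i` while `a, b`
are `<ⱼ`-incomparable for all `j < i`) is well-founded whenever each `<ᵢ` is. -/
theorem composite_order_wellFounded {X : Type*} {m : ℕ} (r : Fin m → X → X → Prop)
    (htrans : ∀ i, Transitive (r i))
    (hasymm : ∀ i, ∀ a b : X, r i a b → ¬ r i b a)
    (hincomp : ∀ i, Transitive (fun a b : X => ¬ r i a b ∧ ¬ r i b a))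
    (hwf : ∀ i, WellFounded (r i)) :
    WellFounded (fun a b : X =>
      ∃ i : Fin m, r i a b ∧ ∀ j < i, ¬ r j a b ∧ ¬ r j b a) := by
  have key : WellFounded (Pi.Lex (fun i j : Fin m => i < j)
      (fun {_} (x y : Ordinal) => x < y)) :=
    Pi.Lex.wellFounded _ (fun _ => wellFounded_lt)
  refine Subrelation.wf ?_ (InvImage.wf (fun a i => ((hwf i).apply a).rank) key)
  rintro a b ⟨i, hi, hj⟩
  refine ⟨i, fun j hji => ?_, ((hwf i).apply b).rank_lt_of_rel hi⟩
  exact le_antisymm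
    (rank_le_of_incomp _ (htrans j) (hincomp j) (hwf j) _ _ (hj j hji))
    (rank_le_of_incomp _ (htrans j) (hincomp j) (hwf j) _ _ (hj j hji).symm)
end

section
/- Let (X, <) be a well-founded strict order, P a set, and ld : P → X a map. On finite multisets over P define M ≺ M' if and only if there exist p ∈ P and a finite multiset L over P with ld(q) < ld(p) for every q occurring in L, such that M + {p} = M' + L (i.e., M is obtained from M' by removing one occurrence of p and adding the elements of L, all of strictly smaller ld-value). Then ≺ is a well-founded relation on finite multisets over P. -/
/-- **Well-foundedness of the queue order `≺₃`.** Let `<` be a well-founded strict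
order on `X` and `ld : P → X`. On finite multisets over `P` define `M ≺ M'` iff
`M + {p} = M' + L` for some `p ∈ P` and some finite multiset `L` all of whose
members `q` satisfy `ld q < ld p`. Then `≺` is well-founded. -/
theorem multiset_leader_order_wellFounded {X P : Type*} (lt : X → X → Prop)
    (htrans : Transitive lt) (hirrefl : Irreflexive lt)
    (hwf : WellFounded lt) (ld : P → X) :
    WellFounded (fun M M' : Multiset P =>
      ∃ (p : P) (L : Multiset P),
        (∀ q ∈ L, lt (ld q) (ld p)) ∧ M + {p} = M' + L) := by
  have h := (InvImage.wf ld hwf).cutExpand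
  refine Subrelation.wf (r := Relation.CutExpand (InvImage lt ld)) ?_ h
  rintro M M' ⟨p, L, hL, he⟩
  exact ⟨L, p, hL, he⟩
end

section
/- Let m, n ≥ 1, D = {1,…,m} × ℕⁿ, with the partial order (u,i) ⊑ (v,j) iff u = v and i_l ≤ j_l for all l (componentwise divisibility within the same indeterminate). Let < be a ranking on D, i.e., a total strict order with (u,i) < (u, i+e_l) and such that d < d' implies (u,i+e_l) < (v,j+e_l) for d=(u,i) < d'=(v,j). On finite subsets A ⊆ D that are antichains with respect to ⊑, define A ≺ B if and only if min_<(A∖B) < min_<(B∖A), where the minimum of the empty set is taken to be a formal top element larger than every element of D. Then ≺ is well-founded on the collection of finite ⊑-antichains of D. -/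
/-- Dickson's lemma for differential variables. -/
theorem dickson_aux (m n : ℕ) : WellQuasiOrdered
    (fun a b : Fin m × (Fin n → ℕ) => a.1 = b.1 ∧ a.2 ≤ b.2) :=
  WellQuasiOrdered.prod (Finite.wellQuasiOrdered (· = ·)) wellQuasiOrdered_le

/-- A ranking refines divisibility. -/
theorem ranking_refines (m n : ℕ)
    (lt : (Fin m × (Fin n → ℕ)) → (Fin m × (Fin n → ℕ)) → Prop)
    (htrans : ∀ a b c, lt a b → lt b c → lt a c)
    (hrank : ∀ (d : Fin m × (Fin n → ℕ)) (l : Fin n),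
      lt d (d.1, d.2 + Pi.single l 1)) (u : Fin m) (N : ℕ) :
    ∀ i j : Fin n → ℕ, i ≤ j → ∑ l, (j l - i l) = N → i = j ∨ lt (u, i) (u, j) := by
  induction N with
  | zero =>
    intro i j hij hs
    left
    funext l
    have h := (Finset.sum_eq_zero_iff.1 hs) l (Finset.mem_univ l)
    have h2 : i l ≤ j l := hij l
    omega
  | succ N ih =>
    intro i j hij hs
    right
    have hne : ∃ l, i l < j l := by
      by_contra hcon
      push Not at hcon
      have : ∑ l, (j l - i l) = 0 := Finset.sum_eq_zero (fun l _ => by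
        have := hcon l
        omega)
      omega
    obtain ⟨l, hl⟩ := hne
    have hle : i + Pi.single l 1 ≤ j := by
      intro k
      by_cases hk : k = l
      · subst hk
        simp
        omega
      · simpa [hk] using hij k
    have hsum : ∑ k, (j k - (i + Pi.single l 1 : Fin n → ℕ) k) = N := by
      have h1 : ∑ k, (j k - i k) =
          ∑ k, ((j k - (i + Pi.single l 1 : Fin n → ℕ) k) + (Pi.single l 1 : Fin n → ℕ) k) := by
        refine Finset.sum_congr rfl (fun k _ => ?_)
        have := hle k
        simp only [Pi.add_apply] at this ⊢
        omega
      rw [Finset.sum_add_distrib] at h1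
      have h2 : ∑ k, (Pi.single l 1 : Fin n → ℕ) k = 1 := by simp
      omega
    have h0 := hrank (u, i) l
    rcases ih _ j hle hsum with h | h
    · rw [← h]
      exact h0
    · exact htrans _ _ _ h0 h

/-- **Well-foundedness of the order `≺₁ₐ` on antichains of differential variables.**
Let `D = {1,…,m} × ℕⁿ` with the divisibility order `⊑` ((u,i) ⊑ (v,j) iff `u = v`
and `i ≤ j` componentwise) and let `<` be a ranking on `D`. On finite
`⊑`-antichains define `A ≺ B` iff `min_<(A∖B) < min_<(B∖A)` (the minimum of the
empty set being a formal top element), i.e. iff `A∖B` has a `<`-minimal element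
`a` which is `<`-smaller than every element of `B∖A`. Then `≺` is well-founded. -/
theorem antichain_min_order_wellFounded (m n : ℕ) (hm : 1 ≤ m) (hn : 1 ≤ n)
    (lt : (Fin m × (Fin n → ℕ)) → (Fin m × (Fin n → ℕ)) → Prop)
    (htrans : Transitive lt) (hirrefl : Irreflexive lt)
    (htotal : ∀ a b : Fin m × (Fin n → ℕ), a ≠ b → lt a b ∨ lt b a)
    (hrank : ∀ (d : Fin m × (Fin n → ℕ)) (l : Fin n),
      lt d (d.1, d.2 + Pi.single l 1))
    (hmono : ∀ (d d' : Fin m × (Fin n → ℕ)) (l : Fin n), lt d d' →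
      lt (d.1, d.2 + Pi.single l 1) (d'.1, d'.2 + Pi.single l 1)) :
    WellFounded (fun (A B : {A : Finset (Fin m × (Fin n → ℕ)) //
        ∀ a ∈ A, ∀ b ∈ A, (a.1 = b.1 ∧ ∀ l, a.2 l ≤ b.2 l) → a = b}) =>
      ∃ a ∈ A.1 \ B.1, (∀ a' ∈ A.1 \ B.1, ¬ lt a' a) ∧ ∀ b ∈ B.1 \ A.1, lt a b) := by
  classical
  have href : ∀ a b : Fin m × (Fin n → ℕ), a.1 = b.1 → a.2 ≤ b.2 → a = b ∨ lt a b := by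
    rintro ⟨u, i⟩ ⟨v, j⟩ huv hij
    simp only at huv hij
    subst huv
    rcases ranking_refines m n lt (fun a b c h1 h2 => htrans h1 h2) hrank u _ i j hij rfl with h | h
    · left
      rw [h]
    · exact Or.inr h
  have hwf : WellFounded lt := by
    haveI : IsStrictOrder _ lt :=
      { irrefl := fun a => hirrefl a, trans := fun a b c h1 h2 => htrans h1 h2 }
    rw [RelEmbedding.wellFounded_iff_isEmpty]
    refine ⟨fun f => ?_⟩
    obtain ⟨i, j, hij, h1, h2⟩ := dickson_aux m n f
    have hlt : lt (f j) (f i) := f.map_rel_iff.2 hij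
    rcases href _ _ h1 h2 with h | h
    · rw [h] at hlt
      exact hirrefl _ hlt
    · exact hirrefl _ (htrans h hlt)
  rw [WellFounded.wellFounded_iff_has_min]
  intro S hS
  -- the limit set, defined by recursion along the ranking
  obtain ⟨L, hL⟩ : ∃ L : Fin m × (Fin n → ℕ) → Prop, ∀ d, L d ↔
      ∃ A ∈ S, d ∈ A.1 ∧ ∀ x, lt x d → (x ∈ A.1 ↔ L x) := by
    refine ⟨hwf.fix (fun d ih => ∃ A ∈ S, d ∈ A.1 ∧ ∀ x (h : lt x d), (x ∈ A.1 ↔ ih x h)), ?_⟩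
    intro d
    rw [hwf.fix_eq]
  -- two comparable elements of the limit set agree
  have hanti : ∀ a b, L a → L b → a.1 = b.1 → a.2 ≤ b.2 → a = b := by
    intro a b ha hb h1 h2
    rcases href a b h1 h2 with h | h
    · exact h
    · obtain ⟨A, _, hbA, hag⟩ := (hL b).1 hb
      exact A.2 a ((hag a h).2 ha) b hbA ⟨h1, h2⟩
  have hfin : {d | L d}.Finite := by
    by_contra hinf
    have hinf : {d | L d}.Infinite := hinf
    obtain ⟨i, j, hij, h1, h2⟩ := dickson_aux m n (fun k => (hinf.natEmbedding _ k).1)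
    have h := hanti _ _ (hinf.natEmbedding _ i).2 (hinf.natEmbedding _ j).2 h1 h2
    have := (hinf.natEmbedding _).injective (Subtype.ext h)
    omega
  -- some member of S agrees with L below a bound containing all of L
  have hex : ∃ A ∈ S, ∀ d, L d → d ∈ A.1 ∧ ∀ x, lt x d → (x ∈ A.1 ↔ L x) := by
    by_cases hne : ∃ d, L d
    · obtain ⟨e, he, hmax⟩ : ∃ e, L e ∧ ∀ d, L d → ¬ lt e d := by
        haveI : IsStrictOrder _ (Function.swap lt) :=
          { irrefl := fun a => hirrefl a, trans := fun a b c h1 h2 => htrans h2 h1 }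
        have hw : {d | L d}.WellFoundedOn (Function.swap lt) := hfin.wellFoundedOn
        obtain ⟨d, hd⟩ := hne
        obtain ⟨⟨e, he⟩, _, hmin⟩ := (WellFounded.wellFounded_iff_has_min.1 hw) Set.univ
          ⟨⟨d, hd⟩, trivial⟩
        exact ⟨e, he, fun d hd => hmin ⟨d, hd⟩ trivial⟩
      obtain ⟨A, hA, heA, hag⟩ := (hL e).1 he
      refine ⟨A, hA, fun d hd => ?_⟩
      by_cases hde : d = e
      · rw [hde]
        exact ⟨heA, hag⟩
      · rcases htotal d e hde with h | h
        · exact ⟨(hag d h).2 hd, fun x hx => hag x (htrans hx h)⟩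
        · exact absurd h (hmax d hd)
    · obtain ⟨A, hA⟩ := hS
      exact ⟨A, hA, fun d hd => absurd ⟨d, hd⟩ hne⟩
  obtain ⟨A, hA, hAL⟩ := hex
  have hsub : ∀ x, x ∈ A.1 → L x := by
    intro x
    induction x using hwf.induction with
    | _ x ih =>
      intro hx
      exact (hL x).2 ⟨A, hA, hx, fun y hy => ⟨fun h => ih y hy h, fun h => (hAL y h).1⟩⟩
  refine ⟨A, hA, ?_⟩
  rintro B hB ⟨a, ha, hmin, hlt⟩
  rw [Finset.mem_sdiff] at ha
  apply ha.2
  refine (hAL a ((hL a).2 ⟨B, hB, ha.1, fun x hx => ⟨fun hxB => ?_, fun hxL => ?_⟩⟩)).1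
  · by_contra hxL
    exact hmin x (Finset.mem_sdiff.2 ⟨hxB, fun h => hxL (hsub x h)⟩) hx
  · by_contra hxB
    exact hirrefl _ (htrans hx (hlt x (Finset.mem_sdiff.2 ⟨(hAL x hxL).1, hxB⟩)))
end
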